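/- Let G be a binary SSG. Let σ₀ be a MAX strategy with nonempty switch set S₀ = S_{σ₀}, let T₀ ⊆ V_MAX with S₀ ⊆ T₀, and let σ₁ be an optimal MAX strategy of the subgame G_{|T₀[σ̄₀]}, where σ̄₀ is the total switch of σ₀ (so σ₁(x) ≠ σ₀(x) for every x ∈ S₀). Suppose S₁ = S_{σ₁} is nonempty, and let σ₂ be an optimal MAX strategy of the subgame G_{|(S₀ ∪ S₁)[σ̄₁]}, where σ̄₁ is the total switch of σ₁. Then there exists x ∈ S₀ \ S₁ with x ∉ S_{σ₂}; in particular S₁ ∪ S_{σ₂} is a proper subset of S₀ ∪ S₁. -/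

import Mathlib

open scoped BigOperators

instance : Fact ((0:ℝ) ≤ 1) := ⟨zero_le_one⟩

/-- A simple stochastic game on a finite vertex set `V`. -/
structure SSG (V : Type*) [Fintype V] [DecidableEq V] where
  /-- MAX vertices -/
  VMax : Finset V
  /-- MIN vertices -/
  VMin : Finset V
  /-- random vertices -/
  VR : Finset V
  /-- sink vertices -/
  VS : Finset V
  cover : ∀ x : V, x ∈ VMax ∨ x ∈ VMin ∨ x ∈ VR ∨ x ∈ VS
  disjMaxMin : Disjoint VMax VMin
  disjMaxR : Disjoint VMax VR
  disjMaxS : Disjoint VMax VS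
  disjMinR : Disjoint VMin VR
  disjMinS : Disjoint VMin VS
  disjRS : Disjoint VR VS
  /-- out-neighbourhood: `y ∈ succ x` iff `(x,y)` is an edge -/
  succ : V → Finset V
  outMax : ∀ x ∈ VMax, 2 ≤ (succ x).card
  outMin : ∀ x ∈ VMin, 2 ≤ (succ x).card
  outR : ∀ x ∈ VR, 1 ≤ (succ x).card
  /-- transition probabilities at random vertices -/
  prob : V → V → ℝ
  prob_nonneg : ∀ x y, 0 ≤ prob x y
  prob_support : ∀ x ∈ VR, ∀ y, y ∉ succ x → prob x y = 0
  prob_sum : ∀ x ∈ VR, (∑ y, prob x y) = 1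
  /-- values of the sinks -/
  val : V → ℝ
  val_mem : ∀ x ∈ VS, val x ∈ Set.Icc (0:ℝ) 1

namespace SSG

variable {V : Type*} [Fintype V] [DecidableEq V]

/-- A positional MAX strategy: a choice of an out-neighbour at every MAX vertex
(normalised to the identity away from `VMax`). -/
structure MaxStrategy (G : SSG V) where
  toFun : V → V
  mem_succ : ∀ x ∈ G.VMax, toFun x ∈ G.succ x
  eq_id : ∀ x ∉ G.VMax, toFun x = x

/-- A positional MIN strategy. -/
structure MinStrategy (G : SSG V) where
  toFun : V → V
  mem_succ : ∀ x ∈ G.VMin, toFun x ∈ G.succ x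
  eq_id : ∀ x ∉ G.VMin, toFun x = x

/-- The one-step (monotone) operator on value vectors associated with `(σ,τ)`. -/
noncomputable def F (G : SSG V) (σ : G.MaxStrategy) (τ : G.MinStrategy)
    (w : V → unitInterval) (x : V) : unitInterval :=
  if _hM : x ∈ G.VMax then w (σ.toFun x)
  else if _hN : x ∈ G.VMin then w (τ.toFun x)
  else if hR : x ∈ G.VR then
    ⟨∑ y, G.prob x y * (w y : ℝ), by
      constructor
      · exact Finset.sum_nonneg fun y _ =>
          mul_nonneg (G.prob_nonneg x y) (w y).2.1
      · calc (∑ y, G.prob x y * (w y : ℝ)) ≤ ∑ y, G.prob x y :=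
              Finset.sum_le_sum fun y _ =>
                mul_le_of_le_one_right (G.prob_nonneg x y) (w y).2.2
          _ = 1 := G.prob_sum x hR⟩
  else ⟨G.val x, G.val_mem x (by
    rcases G.cover x with h | h | h | h
    · exact absurd h _hM
    · exact absurd h _hN
    · exact absurd h hR
    · exact h)⟩

/-- The value vector `v_{σ,τ}`: the least fixed point (à la Knaster–Tarski) of `F`. -/
noncomputable def value (G : SSG V) (σ : G.MaxStrategy) (τ : G.MinStrategy) :
    V → unitInterval :=
  sInf {w : V → unitInterval | G.F σ τ w ≤ w}

/-- `τ` is a best response to `σ`. -/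
def IsBestResponse (G : SSG V) (σ : G.MaxStrategy) (τ : G.MinStrategy) : Prop :=
  ∀ τ' : G.MinStrategy, G.value σ τ ≤ G.value σ τ'

/-- `σ` is an optimal MAX strategy: `v_σ ≥ v_{σ'}` for every MAX strategy `σ'`
(values being computed against best responses). -/
def IsOptimal (G : SSG V) (σ : G.MaxStrategy) : Prop :=
  ∀ τ : G.MinStrategy, G.IsBestResponse σ τ →
    ∀ σ' : G.MaxStrategy, ∀ τ' : G.MinStrategy, G.IsBestResponse σ' τ' →
      G.value σ' τ' ≤ G.value σ τ

/-- The switch set `S_σ` of `σ`, computed with a best response `τ` to `σ`. -/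
def switchSet (G : SSG V) (σ : G.MaxStrategy) (τ : G.MinStrategy) : Set V :=
  {x | x ∈ G.VMax ∧ ∃ y ∈ G.succ x, G.value σ τ x < G.value σ τ y}

/-- `σ'` is a `σ`-switch (w.r.t. a best response `τ` to `σ`). -/
def IsSwitch (G : SSG V) (σ : G.MaxStrategy) (τ : G.MinStrategy)
    (σ' : G.MaxStrategy) : Prop :=
  σ' ≠ σ ∧
  (∀ x ∈ G.VMax, x ∉ G.switchSet σ τ → σ'.toFun x = σ.toFun x) ∧
  (∀ x ∈ G.switchSet σ τ, σ'.toFun x ≠ σ.toFun x →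
    G.value σ τ x < G.value σ τ (σ'.toFun x))

/-- `σ` agrees with `σ₀` on `T`. -/
def AgreesOn (G : SSG V) (T : Set V) (σ₀ σ : G.MaxStrategy) : Prop :=
  ∀ x ∈ T, σ.toFun x = σ₀.toFun x

/-- `σ` is an optimal MAX strategy of the subgame `G_{|T[σ₀]}`: it agrees with `σ₀` on `T`
and its value vector dominates that of every MAX strategy of `G` agreeing with `σ₀` on `T`. -/
def IsOptimalOn (G : SSG V) (T : Set V) (σ₀ σ : G.MaxStrategy) : Prop :=
  G.AgreesOn T σ₀ σ ∧
  ∀ σ' : G.MaxStrategy, G.AgreesOn T σ₀ σ' →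
    ∀ τ τ' : G.MinStrategy, G.IsBestResponse σ τ → G.IsBestResponse σ' τ' →
      G.value σ' τ' ≤ G.value σ τ

/-- `σ'` is a `(σ,T)`-super-switch (w.r.t. a best response `τ` to `σ`): it is obtained from an
intermediate `σ`-switch `σ''` that only switches inside `T`, by taking an optimal strategy of
the subgame `G_{|T[σ'']}`. -/
def IsSuperSwitch (G : SSG V) (σ : G.MaxStrategy) (τ : G.MinStrategy)
    (T : Set V) (σ' : G.MaxStrategy) : Prop :=
  ∃ σ'' : G.MaxStrategy, G.IsSwitch σ τ σ'' ∧
    (∀ x ∈ G.VMax, x ∉ T → σ''.toFun x = σ.toFun x) ∧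
    G.IsOptimalOn T σ'' σ'

/-- A binary SSG: every MAX vertex has outdegree exactly 2. -/
def Binary (G : SSG V) : Prop := ∀ x ∈ G.VMax, (G.succ x).card = 2

/-- `σb` is the total switch `σ̄` of `σ` (in a binary SSG): it switches to the other
out-neighbour exactly on the switch set of `σ`. -/
def IsTotalSwitch (G : SSG V) (σ : G.MaxStrategy) (τ : G.MinStrategy)
    (σb : G.MaxStrategy) : Prop :=
  (∀ x ∈ G.switchSet σ τ, σb.toFun x ≠ σ.toFun x) ∧
  (∀ x ∈ G.VMax, x ∉ G.switchSet σ τ → σb.toFun x = σ.toFun x)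

end SSG

namespace SSG

variable {V : Type*} [Fintype V] [DecidableEq V]

lemma F_max (G : SSG V) (σ : G.MaxStrategy) (τ : G.MinStrategy) (w : V → unitInterval) {x : V}
    (h : x ∈ G.VMax) : G.F σ τ w x = w (σ.toFun x) := by
  simp [F, h]

lemma F_min (G : SSG V) (σ : G.MaxStrategy) (τ : G.MinStrategy) (w : V → unitInterval) {x : V}
    (h : x ∈ G.VMin) : G.F σ τ w x = w (τ.toFun x) := by
  have h1 : x ∉ G.VMax := fun h' => Finset.disjoint_left.1 G.disjMaxMin h' h
  simp [F, h, h1]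

lemma F_rand (G : SSG V) (σ : G.MaxStrategy) (τ : G.MinStrategy) (w : V → unitInterval) {x : V}
    (h : x ∈ G.VR) : ((G.F σ τ w x : unitInterval) : ℝ) = ∑ y, G.prob x y * (w y : ℝ) := by
  have h1 : x ∉ G.VMax := fun h' => Finset.disjoint_left.1 G.disjMaxR h' h
  have h2 : x ∉ G.VMin := fun h' => Finset.disjoint_left.1 G.disjMinR h' h
  simp [F, h, h1, h2]

lemma F_sink (G : SSG V) (σ : G.MaxStrategy) (τ : G.MinStrategy) (w : V → unitInterval) {x : V}
    (h : x ∈ G.VS) : ((G.F σ τ w x : unitInterval) : ℝ) = G.val x := by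
  have h1 : x ∉ G.VMax := fun h' => Finset.disjoint_left.1 G.disjMaxS h' h
  have h2 : x ∉ G.VMin := fun h' => Finset.disjoint_left.1 G.disjMinS h' h
  have h3 : x ∉ G.VR := fun h' => Finset.disjoint_left.1 G.disjRS h' h
  simp [F, h1, h2, h3]

/-- Comparison of the operators for two strategy pairs. -/
lemma F_le_F (G : SSG V) (σ σ' : G.MaxStrategy) (τ τ' : G.MinStrategy)
    (w w' : V → unitInterval) (h : w ≤ w')
    (hM : ∀ x ∈ G.VMax, w (σ.toFun x) ≤ w' (σ'.toFun x))
    (hN : ∀ x ∈ G.VMin, w (τ.toFun x) ≤ w' (τ'.toFun x)) :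
    G.F σ τ w ≤ G.F σ' τ' w' := by
  intro x
  rcases G.cover x with hx | hx | hx | hx
  · rw [F_max _ _ _ _ hx, F_max _ _ _ _ hx]; exact hM x hx
  · rw [F_min _ _ _ _ hx, F_min _ _ _ _ hx]; exact hN x hx
  · rw [← Subtype.coe_le_coe, F_rand _ _ _ _ hx, F_rand _ _ _ _ hx]
    exact Finset.sum_le_sum fun y _ => mul_le_mul_of_nonneg_left (h y) (G.prob_nonneg x y)
  · rw [← Subtype.coe_le_coe, F_sink _ _ _ _ hx, F_sink _ _ _ _ hx]

lemma F_mono (G : SSG V) (σ : G.MaxStrategy) (τ : G.MinStrategy) : Monotone (G.F σ τ) :=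
  fun _ _ h => G.F_le_F σ σ τ τ _ _ h (fun _ _ => h _) (fun _ _ => h _)

lemma value_le (G : SSG V) (σ : G.MaxStrategy) (τ : G.MinStrategy) (w : V → unitInterval)
    (h : G.F σ τ w ≤ w) : G.value σ τ ≤ w := sInf_le h

lemma F_value (G : SSG V) (σ : G.MaxStrategy) (τ : G.MinStrategy) :
    G.F σ τ (G.value σ τ) = G.value σ τ := by
  have h1 : G.F σ τ (G.value σ τ) ≤ G.value σ τ :=
    le_sInf fun w hw => (G.F_mono σ τ (G.value_le σ τ w hw)).trans hw
  exact le_antisymm h1 (G.value_le σ τ _ (G.F_mono σ τ h1))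

lemma value_max (G : SSG V) (σ : G.MaxStrategy) (τ : G.MinStrategy) {x : V}
    (hx : x ∈ G.VMax) : G.value σ τ x = G.value σ τ (σ.toFun x) := by
  conv_lhs => rw [← F_value, F_max _ _ _ _ hx]

lemma value_min (G : SSG V) (σ : G.MaxStrategy) (τ : G.MinStrategy) {x : V}
    (hx : x ∈ G.VMin) : G.value σ τ x = G.value σ τ (τ.toFun x) := by
  conv_lhs => rw [← F_value, F_min _ _ _ _ hx]

lemma value_rand (G : SSG V) (σ : G.MaxStrategy) (τ : G.MinStrategy) {x : V}
    (hx : x ∈ G.VR) : (G.value σ τ x : ℝ) = ∑ y, G.prob x y * (G.value σ τ y : ℝ) := by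
  conv_lhs => rw [← F_value, F_rand _ _ _ _ hx]

lemma value_sink (G : SSG V) (σ : G.MaxStrategy) (τ : G.MinStrategy) {x : V}
    (hx : x ∈ G.VS) : (G.value σ τ x : ℝ) = G.val x := by
  conv_lhs => rw [← F_value, F_sink _ _ _ _ hx]

/-- A best response exists. -/
lemma exists_bestResponse (G : SSG V) (σ : G.MaxStrategy) : ∃ τ, G.IsBestResponse σ τ := by
  set u : V → unitInterval := ⨅ τ', G.value σ τ' with hu
  have hmin : ∀ x, ∃ y, (x ∈ G.VMin → y ∈ G.succ x ∧ ∀ z ∈ G.succ x, u y ≤ u z) ∧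
      (x ∉ G.VMin → y = x) := by
    intro x
    by_cases hx : x ∈ G.VMin
    · have hne : (G.succ x).Nonempty := by
        rw [← Finset.card_pos]; have := G.outMin x hx; omega
      obtain ⟨y, hy, hy'⟩ := Finset.exists_min_image (G.succ x) u hne
      exact ⟨y, fun _ => ⟨hy, hy'⟩, fun h => absurd hx h⟩
    · exact ⟨x, fun h => absurd h hx, fun _ => rfl⟩
  choose t ht1 ht2 using hmin
  let τ : G.MinStrategy := ⟨t, fun x hx => (ht1 x hx).1, ht2⟩
  refine ⟨τ, fun τ' => ?_⟩
  have hle : G.F σ τ u ≤ u := by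
    rw [hu]
    refine le_iInf fun τ'' => ?_
    rw [← hu]
    rw [← F_value]
    have h1 : u ≤ G.value σ τ'' := iInf_le _ τ''
    exact G.F_le_F σ σ τ τ'' _ _ h1 (fun x _ => h1 _)
      (fun x hx => ((ht1 x hx).2 _ (τ''.mem_succ x hx)).trans (h1 _))
  exact (G.value_le σ τ u hle).trans (iInf_le _ τ')

/-- Values against a best response are minimal over the out-neighbours at MIN vertices. -/
lemma bestResponse_min (G : SSG V) (σ : G.MaxStrategy) (τ : G.MinStrategy)
    (hbr : G.IsBestResponse σ τ) {x : V} (hx : x ∈ G.VMin) {y : V} (hy : y ∈ G.succ x) :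
    G.value σ τ x ≤ G.value σ τ y := by
  by_contra hlt
  rw [not_le] at hlt
  let τ' : G.MinStrategy := ⟨Function.update τ.toFun x y, by
    intro z hz
    by_cases h : z = x
    · subst h; simpa using hy
    · simpa [h] using τ.mem_succ z hz, by
    intro z hz
    have h : z ≠ x := fun h => hz (h ▸ hx)
    simpa [h] using τ.eq_id z hz⟩
  have h1 : G.F σ τ' (G.value σ τ) ≤ G.value σ τ := by
    conv_rhs => rw [← F_value]
    refine G.F_le_F _ _ _ _ _ _ le_rfl (fun _ _ => le_rfl) fun z hz => ?_
    by_cases h : z = x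
    · subst h
      rw [← value_min _ _ _ hz]
      simpa [τ'] using hlt.le
    · simp [τ', h]
  have h2 : G.value σ τ' = G.value σ τ := le_antisymm (G.value_le _ _ _ h1) (hbr τ')
  have h3 := G.value_min σ τ' hx
  rw [h2] at h3
  simp only [τ', Function.update_self] at h3
  exact absurd h3 hlt.ne'

/-- Strict switches improve the value, against any reply of MIN. -/
lemma improve (G : SSG V) (σ σ' : G.MaxStrategy) (τ τ' : G.MinStrategy)
    (hbr : G.IsBestResponse σ τ)
    (hsw : ∀ x ∈ G.VMax, σ'.toFun x ≠ σ.toFun x →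
      G.value σ τ x < G.value σ τ (σ'.toFun x)) :
    G.value σ τ ≤ G.value σ' τ' := by
  by_contra hnot
  set v := G.value σ τ with hv
  set w := G.value σ' τ' with hw
  obtain ⟨x₁, hx₁⟩ : ∃ x, ¬ v x ≤ w x := by
    by_contra h; push Not at h; exact hnot h
  obtain ⟨x₀, -, hx₀⟩ := Finset.exists_max_image Finset.univ
    (fun x => (v x : ℝ) - (w x : ℝ)) ⟨x₁, Finset.mem_univ _⟩
  set d := (v x₀ : ℝ) - (w x₀ : ℝ) with hd
  have hmax : ∀ x, (v x : ℝ) - (w x : ℝ) ≤ d := fun x => hx₀ x (Finset.mem_univ _)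
  have hdpos : 0 < d := by
    have h1 := hmax x₁
    have h2 : (w x₁ : ℝ) < v x₁ := by
      rw [not_le] at hx₁; exact hx₁
    linarith
  classical
  let z : V → unitInterval := fun x =>
    if (v x : ℝ) - (w x : ℝ) = d then 0 else G.value σ τ' x
  have hzD : ∀ x, (v x : ℝ) - (w x : ℝ) = d → z x = 0 := fun x hx => by simp [z, hx]
  have hzle : z ≤ G.value σ τ' := by
    intro x
    by_cases h : (v x : ℝ) - (w x : ℝ) = d
    · rw [hzD x h]; exact unitInterval.nonneg'
    · simp [z, h]
  have hz : G.F σ τ' z ≤ z := by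
    intro x
    by_cases hxD : (v x : ℝ) - (w x : ℝ) = d
    · rw [hzD x hxD]
      rcases G.cover x with hx | hx | hx | hx
      · rw [F_max _ _ _ _ hx]
        have e1 : v x = v (σ.toFun x) := G.value_max σ τ hx
        have e2 : w x = w (σ'.toFun x) := G.value_max σ' τ' hx
        have e3 : σ'.toFun x = σ.toFun x := by
          by_contra hne
          have h1 : (v x : ℝ) < v (σ'.toFun x) := hsw x hx hne
          have h2 := hmax (σ'.toFun x)
          rw [← e2] at h2
          linarith
        rw [hzD]
        rw [← e1, ← e3, ← e2]; exact hxD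
      · rw [F_min _ _ _ _ hx]
        have e2 : w x = w (τ'.toFun x) := G.value_min σ' τ' hx
        have h1 : (v x : ℝ) ≤ v (τ'.toFun x) :=
          G.bestResponse_min σ τ hbr hx (τ'.mem_succ x hx)
        have h2 := hmax (τ'.toFun x)
        rw [← e2] at h2
        rw [hzD]
        rw [← e2]; linarith
      · have e1 : (v x : ℝ) = _ := G.value_rand σ τ hx
        have e2 : (w x : ℝ) = _ := G.value_rand σ' τ' hx
        have e3 : ∑ y, G.prob x y * (d - ((v y : ℝ) - (w y : ℝ))) = 0 := by
          simp only [mul_sub, Finset.sum_sub_distrib, ← Finset.sum_mul, G.prob_sum x hx]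
          rw [← hv] at e1
          rw [← hw] at e2
          rw [← e1, ← e2]; linarith
        rw [Finset.sum_eq_zero_iff_of_nonneg (fun y _ =>
          mul_nonneg (G.prob_nonneg x y) (sub_nonneg.2 (hmax y)))] at e3
        rw [← Subtype.coe_le_coe, F_rand _ _ _ _ hx]
        refine le_of_eq ?_
        refine Finset.sum_eq_zero fun y hy => ?_
        rcases mul_eq_zero.1 (e3 y hy) with h | h
        · rw [h, zero_mul]
        · rw [hzD y (by linarith)]; simp
      · have e1 : (v x : ℝ) = _ := G.value_sink σ τ hx
        have e2 : (w x : ℝ) = _ := G.value_sink σ' τ' hx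
        linarith
    · have : z x = G.value σ τ' x := by simp [z, hxD]
      rw [this, ← F_value]
      exact G.F_mono σ τ' hzle x
  have h1 : v x₀ ≤ 0 := by
    have := (hbr τ').trans (G.value_le σ τ' z hz) x₀
    rwa [hzD x₀ rfl] at this
  have h2 : (v x₀ : ℝ) ≤ 0 := h1
  have h3 : (0:ℝ) ≤ w x₀ := (w x₀).2.1
  linarith

/-- In a binary game, two choices different from a third one coincide. -/
lemma binary_eq (G : SSG V) (hbin : G.Binary) {x a b c : V} (hx : x ∈ G.VMax)
    (ha : a ∈ G.succ x) (hb : b ∈ G.succ x) (hc : c ∈ G.succ x) (hac : a ≠ c) (hbc : b ≠ c) :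
    a = b := by
  by_contra hab
  have h3 : ({a, b, c} : Finset V).card = 3 := Finset.card_eq_three.2 ⟨a, b, c, hab, hac, hbc, rfl⟩
  have hsub : ({a, b, c} : Finset V) ⊆ G.succ x := by
    intro y hy
    simp only [Finset.mem_insert, Finset.mem_singleton] at hy
    rcases hy with rfl | rfl | rfl <;> assumption
  have := Finset.card_le_card hsub
  rw [hbin x hx] at this
  omega

/-- On the switch set, any other out-neighbour than the current one is strictly better. -/
lemma switch_lt (G : SSG V) (hbin : G.Binary) (σ : G.MaxStrategy) (τ : G.MinStrategy)
    {x y : V} (hx : x ∈ G.switchSet σ τ) (hy : y ∈ G.succ x) (hne : y ≠ σ.toFun x) :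
    G.value σ τ x < G.value σ τ y := by
  obtain ⟨hM, z, hz, hlt⟩ := hx
  have hzne : z ≠ σ.toFun x := by
    rintro rfl
    rw [← value_max _ _ _ hM] at hlt
    exact lt_irrefl _ hlt
  rw [G.binary_eq hbin hM hy hz (σ.mem_succ x hM) hne hzne]
  exact hlt

lemma totalSwitch_improve (G : SSG V) (hbin : G.Binary) (σ σb : G.MaxStrategy)
    (τ τ' : G.MinStrategy) (hbr : G.IsBestResponse σ τ) (hts : G.IsTotalSwitch σ τ σb) :
    G.value σ τ ≤ G.value σb τ' := by
  refine G.improve σ σb τ τ' hbr fun x hx hne => ?_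
  have hxS : x ∈ G.switchSet σ τ := by
    by_contra h; exact hne (hts.2 x hx h)
  exact G.switch_lt hbin σ τ hxS (σb.mem_succ x hx) hne

end SSG

/-- one step of the DecreasingFixedSet algorithm on a binary SSG. With
`S₀ = S_{σ₀}` nonempty, `S₀ ⊆ T₀ ⊆ V_MAX`, `σ₁` optimal in `G_{|T₀[σ̄₀]}`, `S₁ = S_{σ₁}`
nonempty, and `σ₂` optimal in `G_{|(S₀ ∪ S₁)[σ̄₁]}`, there is `x ∈ S₀ \ S₁` with
`x ∉ S_{σ₂}`; in particular `S₁ ∪ S_{σ₂} ⊊ S₀ ∪ S₁`. -/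
theorem decreasingFixedSet_step {V : Type*} [Fintype V] [DecidableEq V] (G : SSG V)
    (hbin : G.Binary) (σ₀ σb₀ σ₁ σb₁ σ₂ : G.MaxStrategy) (τ₀ τ₁ τ₂ : G.MinStrategy)
    (hbr₀ : G.IsBestResponse σ₀ τ₀) (hbr₁ : G.IsBestResponse σ₁ τ₁)
    (hbr₂ : G.IsBestResponse σ₂ τ₂)
    (T₀ : Set V) (hT₀max : T₀ ⊆ ↑G.VMax)
    (hS₀ne : (G.switchSet σ₀ τ₀).Nonempty) (hS₀T₀ : G.switchSet σ₀ τ₀ ⊆ T₀)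
    (hts₀ : G.IsTotalSwitch σ₀ τ₀ σb₀)
    (hσ₁ : G.IsOptimalOn T₀ σb₀ σ₁)
    (hS₁ne : (G.switchSet σ₁ τ₁).Nonempty)
    (hts₁ : G.IsTotalSwitch σ₁ τ₁ σb₁)
    (hσ₂ : G.IsOptimalOn (G.switchSet σ₀ τ₀ ∪ G.switchSet σ₁ τ₁) σb₁ σ₂) :
    (∃ x ∈ G.switchSet σ₀ τ₀ \ G.switchSet σ₁ τ₁, x ∉ G.switchSet σ₂ τ₂) ∧
    (G.switchSet σ₁ τ₁ ∪ G.switchSet σ₂ τ₂) ⊂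
      (G.switchSet σ₀ τ₀ ∪ G.switchSet σ₁ τ₁) := by
  have hS₂ : G.switchSet σ₂ τ₂ ⊆ G.switchSet σ₀ τ₀ ∪ G.switchSet σ₁ τ₁ := by
    intro x hx
    by_contra hxT
    obtain ⟨hM, y, hy, hlt⟩ := hx
    let σ' : G.MaxStrategy := ⟨Function.update σ₂.toFun x y, by
      intro z hz
      by_cases h : z = x
      · subst h; simpa using hy
      · simpa [h] using σ₂.mem_succ z hz, by
      intro z hz
      have h : z ≠ x := fun h => hz (h ▸ hM)
      simpa [h] using σ₂.eq_id z hz⟩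
    obtain ⟨τ', hbr'⟩ := G.exists_bestResponse σ'
    have hag : G.AgreesOn (G.switchSet σ₀ τ₀ ∪ G.switchSet σ₁ τ₁) σb₁ σ' := by
      intro z hz
      have h : z ≠ x := fun h => hxT (h ▸ hz)
      simpa [σ', h] using hσ₂.1 z hz
    have h1 := hσ₂.2 σ' hag τ₂ τ' hbr₂ hbr'
    have h2 : G.value σ₂ τ₂ ≤ G.value σ' τ' := by
      refine G.improve σ₂ σ' τ₂ τ' hbr₂ fun z hz hne => ?_
      by_cases h : z = x
      · subst h; simpa [σ'] using hlt
      · exact absurd (by simp [σ', h]) hne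
    have h3 := G.value_max σ' τ' hM
    rw [le_antisymm h1 h2] at h3
    simp only [σ', Function.update_self] at h3
    exact absurd h3 hlt.ne
  have hmain : ∃ x ∈ G.switchSet σ₀ τ₀ \ G.switchSet σ₁ τ₁, x ∉ G.switchSet σ₂ τ₂ := by
    by_contra hno
    push Not at hno
    classical
    obtain ⟨τb₀, hb₀⟩ := G.exists_bestResponse σb₀
    obtain ⟨τb₁, hb₁⟩ := G.exists_bestResponse σb₁
    have h0b : G.value σ₀ τ₀ ≤ G.value σb₀ τb₀ :=
      G.totalSwitch_improve hbin σ₀ σb₀ τ₀ τb₀ hbr₀ hts₀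
    have hb1 : G.value σb₀ τb₀ ≤ G.value σ₁ τ₁ :=
      hσ₁.2 σb₀ (fun _ _ => rfl) τ₁ τb₀ hbr₁ hb₀
    have h12 : G.value σ₁ τ₁ ≤ G.value σ₂ τ₂ :=
      (G.totalSwitch_improve hbin σ₁ σb₁ τ₁ τb₁ hbr₁ hts₁).trans
        (hσ₂.2 σb₁ (fun _ _ => rfl) τ₂ τb₁ hbr₂ hb₁)
    let σ₃ : G.MaxStrategy := ⟨fun x => if x ∈ G.switchSet σ₀ τ₀ then σ₀.toFun x
        else σ₂.toFun x, by
      intro x hx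
      split_ifs
      · exact σ₀.mem_succ x hx
      · exact σ₂.mem_succ x hx, by
      intro x hx
      split_ifs
      · exact σ₀.eq_id x hx
      · exact σ₂.eq_id x hx⟩
    have h23 : G.value σ₂ τ₂ ≤ G.value σ₃ τ₀ := by
      refine G.improve σ₂ σ₃ τ₂ τ₀ hbr₂ fun x hx hne => ?_
      have hxS₀ : x ∈ G.switchSet σ₀ τ₀ := by
        by_contra h; exact hne (by simp [σ₃, h])
      have e3 : σ₃.toFun x = σ₀.toFun x := by simp [σ₃, hxS₀]
      have e1 : σ₁.toFun x ≠ σ₀.toFun x := by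
        rw [hσ₁.1 x (hS₀T₀ hxS₀)]; exact hts₀.1 x hxS₀
      have e2 : σ₂.toFun x = σb₁.toFun x := hσ₂.1 x (Or.inl hxS₀)
      have hxS₁ : x ∉ G.switchSet σ₁ τ₁ := by
        intro h
        have e4 := hts₁.1 x h
        apply hne
        rw [e3, e2]
        exact G.binary_eq hbin hx (σ₀.mem_succ x hx) (σb₁.mem_succ x hx)
          (σ₁.mem_succ x hx) e1.symm e4
      exact G.switch_lt hbin σ₂ τ₂ (hno x ⟨hxS₀, hxS₁⟩) (σ₃.mem_succ x hx) hne
    have h30 : G.value σ₃ τ₀ ≤ G.value σ₀ τ₀ := by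
      apply G.value_le
      conv_rhs => rw [← SSG.F_value]
      refine G.F_le_F _ _ _ _ _ _ le_rfl (fun x hx => ?_) fun _ _ => le_rfl
      by_cases hxS : x ∈ G.switchSet σ₀ τ₀
      · simp [σ₃, hxS]
      · rw [← SSG.value_max _ _ _ hx]
        by_contra h
        rw [not_le] at h
        exact hxS ⟨hx, _, σ₃.mem_succ x hx, h⟩
    have heq : G.value σb₀ τb₀ = G.value σ₀ τ₀ :=
      le_antisymm (hb1.trans (h12.trans (h23.trans h30))) h0b
    obtain ⟨x, hx⟩ := hS₀ne
    have h1 := G.switch_lt hbin σ₀ τ₀ hx (σb₀.mem_succ x hx.1) (hts₀.1 x hx)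
    have h2 := G.value_max σb₀ τb₀ hx.1
    rw [heq] at h2
    exact absurd h2 h1.ne
  refine ⟨hmain, ?_⟩
  obtain ⟨x, ⟨hx0, hx1⟩, hx2⟩ := hmain
  refine ⟨Set.union_subset Set.subset_union_right hS₂, fun h => ?_⟩
  rcases h (Or.inl hx0) with h | h
  · exact hx1 h
  · exact hx2 h
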